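/- Let β₁, β₂ ∈ [−1,1] with |β₁β₂| ≠ 1, µ ∈ ℝ, t > 0, z > 0, x, y ∈ ℝ and 𝔞 ≥ 0. For a fixed z > 0 and x,y ∈ ℝ set a₁(x,y)=0, a₂(x,y)=|x|+|y|−|y−x|, a₃(x,y)=|x−z|+|y−z|−|y−x|, a₄(x,y)=2(z−max(x,y,0))⁺+2 min(x,y,z)⁺, and define c₁(y;w)=(w+β₁µ)(w+β₂µ), c₂(y;w)=(2·1_{y>0}−1)(β₁w−(2·1_{y>0}−1)β₁µ)(w−(2·1_{y>z}−1)β₂µ), c₃(y;w)=(2·1_{y>z}−1)(β₂w−(2·1_{y>z}−1)β₂µ)(w+(2·1_{y>0}−1)β₁µ), c₄(y;w)=(1−2·1_{[0,z)}(y))(β₁β₂w²−β₁β₂µ²). For u ∈ ℝ define I_u := ∫_0^{𝔞} e^{(𝔴+iu)² t/2} e^{−(𝔴+iu)|x−y|} · [∑_{j=1}^4 c_j(y; 𝔴+iu) e^{−(𝔴+iu) a_j(x,y)}] / [β₁β₂ e^{−2(𝔴+iu)z}((𝔴+iu)²−µ²) + (𝔴+iu+β₁µ)(𝔴+iu+β₂µ)]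 d𝔴 (with the convention that the integrand is 0 wherever the denominator vanishes). Then I_u → 0 as u → +∞ and as u → −∞. -/

import Mathlib

open MeasureTheory Filter

/-- `a₁(x,y) = 0`. -/
noncomputable def a1 (z x y : ℝ) : ℝ := 0
/-- `a₂(x,y) = |x| + |y| − |y−x|`. -/
noncomputable def a2 (z x y : ℝ) : ℝ := |x| + |y| - |y - x|
/-- `a₃(x,y) = |x−z| + |y−z| − |y−x|`. -/
noncomputable def a3 (z x y : ℝ) : ℝ := |x - z| + |y - z| - |y - x|
/-- `a₄(x,y) = 2(z − max(x,y,0))⁺ + 2 min(x,y,z)⁺`. -/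
noncomputable def a4 (z x y : ℝ) : ℝ :=
  2 * max (z - max (max x y) 0) 0 + 2 * max (min (min x y) z) 0

/-- `2·1_{y>0} − 1`. -/
noncomputable def sg0 (y : ℝ) : ℝ := 2 * (if 0 < y then (1 : ℝ) else 0) - 1
/-- `2·1_{y>z} − 1`. -/
noncomputable def sgz (z y : ℝ) : ℝ := 2 * (if z < y then (1 : ℝ) else 0) - 1
/-- `1 − 2·1_{[0,z)}(y)`. -/
noncomputable def sg4 (z y : ℝ) : ℝ := 1 - 2 * (if 0 ≤ y ∧ y < z then (1 : ℝ) else 0)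

/-- `c₁(y;w) = (w + β₁µ)(w + β₂µ)`. -/
noncomputable def c1 (β₁ β₂ μ z y : ℝ) (w : ℂ) : ℂ :=
  (w + (β₁ * μ : ℝ)) * (w + (β₂ * μ : ℝ))
/-- `c₂(y;w) = (2·1_{y>0}−1)(β₁w − (2·1_{y>0}−1)β₁µ)(w − (2·1_{y>z}−1)β₂µ)`. -/
noncomputable def c2 (β₁ β₂ μ z y : ℝ) (w : ℂ) : ℂ :=
  (sg0 y : ℝ) * ((β₁ : ℝ) * w - (sg0 y * β₁ * μ : ℝ)) * (w - (sgz z y * β₂ * μ : ℝ))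
/-- `c₃(y;w) = (2·1_{y>z}−1)(β₂w − (2·1_{y>z}−1)β₂µ)(w + (2·1_{y>0}−1)β₁µ)`. -/
noncomputable def c3 (β₁ β₂ μ z y : ℝ) (w : ℂ) : ℂ :=
  (sgz z y : ℝ) * ((β₂ : ℝ) * w - (sgz z y * β₂ * μ : ℝ)) * (w + (sg0 y * β₁ * μ : ℝ))
/-- `c₄(y;w) = (1 − 2·1_{[0,z)}(y))(β₁β₂w² − β₁β₂µ²)`. -/
noncomputable def c4 (β₁ β₂ μ z y : ℝ) (w : ℂ) : ℂ :=
  (sg4 z y : ℝ) * ((β₁ * β₂ : ℝ) * w ^ 2 - (β₁ * β₂ * μ ^ 2 : ℝ))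


lemma sg0_abs (y : ℝ) : ‖((sg0 y : ℝ) : ℂ)‖ = 1 := by
  unfold sg0; split_ifs <;> norm_num
lemma sgz_abs (z y : ℝ) : ‖((sgz z y : ℝ) : ℂ)‖ = 1 := by
  unfold sgz; split_ifs <;> norm_num
lemma sg4_abs (z y : ℝ) : ‖((sg4 z y : ℝ) : ℂ)‖ = 1 := by
  unfold sg4; split_ifs <;> norm_num

lemma lin_bound (w : ℂ) (β μ s : ℝ) (hβ : |β| ≤ 1) (hs : |s| ≤ 1) :
    ‖w + (s * β * μ : ℝ)‖ ≤ ‖w‖ + |μ| ∧ ‖w - (s * β * μ : ℝ)‖ ≤ ‖w‖ + |μ| := by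
  have h : ‖((s * β * μ : ℝ) : ℂ)‖ ≤ |μ| := by
    rw [Complex.norm_real, Real.norm_eq_abs, abs_mul, abs_mul]
    have h1 : |s| * |β| ≤ 1 := mul_le_one₀ hs (abs_nonneg _) hβ
    nlinarith [abs_nonneg μ]
  exact ⟨(norm_add_le _ _).trans (by linarith), (norm_sub_le _ _).trans (by linarith)⟩

lemma lin_bound2 (w : ℂ) (β μ s : ℝ) (hβ : |β| ≤ 1) (hs : |s| ≤ 1) :
    ‖(β : ℂ) * w - (s * β * μ : ℝ)‖ ≤ ‖w‖ + |μ| := by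
  have e : (β : ℂ) * w - (s * β * μ : ℝ) = β * (w - (s * 1 * μ : ℝ)) := by push_cast; ring
  rw [e, norm_mul, Complex.norm_real, Real.norm_eq_abs]
  have h := (lin_bound w 1 μ s (by simp) hs).2
  calc _ ≤ 1 * ‖w - (s * 1 * μ : ℝ)‖ := by gcongr
    _ ≤ _ := by rw [one_mul]; exact h

lemma sq_bound (w : ℂ) (μ : ℝ) : ‖w ^ 2 - (μ ^ 2 : ℝ)‖ ≤ ‖w‖ ^ 2 + |μ| ^ 2 := by
  refine (norm_sub_le _ _).trans ?_
  rw [norm_pow, Complex.norm_real, Real.norm_eq_abs, abs_pow]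

lemma c1_bound (β₁ β₂ μ z y : ℝ) (w : ℂ) (h1 : |β₁| ≤ 1) (h2 : |β₂| ≤ 1) :
    ‖c1 β₁ β₂ μ z y w‖ ≤ (‖w‖ + |μ|) ^ 2 := by
  have := (lin_bound w β₁ μ 1 h1 (by simp)).1
  have := (lin_bound w β₂ μ 1 h2 (by simp)).1
  rw [one_mul] at *
  unfold c1; rw [norm_mul, sq]; gcongr

lemma c2_bound (β₁ β₂ μ z y : ℝ) (w : ℂ) (h1 : |β₁| ≤ 1) (h2 : |β₂| ≤ 1) :
    ‖c2 β₁ β₂ μ z y w‖ ≤ (‖w‖ + |μ|) ^ 2 := by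
  have e1 : |sg0 y| = 1 := by simpa using sg0_abs y
  have e2 : |sgz z y| = 1 := by simpa using sgz_abs z y
  have := lin_bound2 w β₁ μ (sg0 y) h1 e1.le
  have := (lin_bound w β₂ μ (sgz z y) h2 e2.le).2
  unfold c2; rw [norm_mul, norm_mul, sg0_abs, one_mul, sq]; gcongr

lemma c3_bound (β₁ β₂ μ z y : ℝ) (w : ℂ) (h1 : |β₁| ≤ 1) (h2 : |β₂| ≤ 1) :
    ‖c3 β₁ β₂ μ z y w‖ ≤ (‖w‖ + |μ|) ^ 2 := by
  have e1 : |sg0 y| = 1 := by simpa using sg0_abs y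
  have e2 : |sgz z y| = 1 := by simpa using sgz_abs z y
  have := lin_bound2 w β₂ μ (sgz z y) h2 e2.le
  have := (lin_bound w β₁ μ (sg0 y) h1 e1.le).1
  unfold c3; rw [norm_mul, norm_mul, sgz_abs, one_mul, sq]; gcongr

lemma c4_bound (β₁ β₂ μ z y : ℝ) (w : ℂ) (h1 : |β₁| ≤ 1) (h2 : |β₂| ≤ 1) :
    ‖c4 β₁ β₂ μ z y w‖ ≤ (‖w‖ + |μ|) ^ 2 := by
  have e : ((β₁ * β₂ : ℝ) : ℂ) * w ^ 2 - (β₁ * β₂ * μ ^ 2 : ℝ)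
      = (β₁ * β₂ : ℝ) * (w ^ 2 - (μ ^ 2 : ℝ)) := by push_cast; ring
  have h := sq_bound w μ
  have hb : |β₁ * β₂| ≤ 1 := by rw [abs_mul]; exact mul_le_one₀ h1 (abs_nonneg _) h2
  unfold c4; rw [e, norm_mul, norm_mul, sg4_abs, one_mul, Complex.norm_real, Real.norm_eq_abs]
  calc _ ≤ 1 * ‖w ^ 2 - (μ ^ 2 : ℝ)‖ := by gcongr
    _ ≤ _ := by nlinarith [norm_nonneg w, abs_nonneg μ, mul_nonneg (norm_nonneg w) (abs_nonneg μ)]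

lemma exp_bound (v u a A : ℝ) (h0 : 0 ≤ v) (h1 : v ≤ A) :
    ‖Complex.exp (-((v : ℂ) + Complex.I * u) * (a : ℝ))‖ ≤ Real.exp (A * |a|) := by
  rw [Complex.norm_exp]
  apply Real.exp_le_exp.2
  have : (-((v : ℂ) + Complex.I * u) * (a : ℝ)).re = -(v * a) := by simp
  rw [this]
  nlinarith [neg_abs_le a, abs_nonneg a, mul_le_mul_of_nonneg_right h1 (abs_nonneg a),
    mul_le_mul_of_nonneg_left (neg_abs_le a) h0]

lemma gauss_bound (v u t A : ℝ) (ht : 0 < t) (h0 : 0 ≤ v) (h1 : v ≤ A) :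
    ‖Complex.exp (((v : ℂ) + Complex.I * u) ^ 2 * t / 2)‖
      ≤ Real.exp (A ^ 2 * t / 2) * Real.exp (-(t / 2) * |u| ^ 2) := by
  rw [Complex.norm_exp, ← Real.exp_add]
  apply Real.exp_le_exp.2
  have e : ((v : ℂ) + Complex.I * u) ^ 2 * t / 2
      = (((v ^ 2 - u ^ 2) * t / 2 : ℝ) : ℂ) + ((v * u * t : ℝ) : ℂ) * Complex.I := by
    push_cast; linear_combination ((u:ℂ)^2 * t / 2) * Complex.I_sq
  have : (((v : ℂ) + Complex.I * u) ^ 2 * t / 2).re = (v ^ 2 - u ^ 2) * t / 2 := by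
    rw [e]; simp [-Complex.ofReal_mul, -Complex.ofReal_div, -Complex.ofReal_sub, -Complex.ofReal_pow]
  rw [this, sq_abs]
  have : v ^ 2 ≤ A ^ 2 := by gcongr
  nlinarith

lemma den_bound (β₁ β₂ μ z : ℝ) (w : ℂ) (h1 : |β₁| ≤ 1) (h2 : |β₂| ≤ 1) (hz : 0 < z)
    (hw : 0 ≤ w.re) (hW1 : 1 ≤ ‖w‖) (hWM : |μ| ≤ ‖w‖) (hb : |β₁ * β₂| < 1)
    (hW : 2 * |μ| + 1 ≤ (1 - |β₁ * β₂|) * ‖w‖) :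
    1 ≤ ‖((β₁ * β₂ : ℝ) * Complex.exp (-2 * w * z) * (w ^ 2 - (μ ^ 2 : ℝ)) +
              (w + (β₁ * μ : ℝ)) * (w + (β₂ * μ : ℝ)))‖ := by
  have key : ∀ β : ℝ, |β| ≤ 1 → ‖w‖ - |μ| ≤ ‖w + (β * μ : ℝ)‖ := by
    intro β hβ
    have h := norm_sub_le (w + (β * μ : ℝ)) ((β * μ : ℝ) : ℂ)
    rw [add_sub_cancel_right, Complex.norm_real, Real.norm_eq_abs, abs_mul] at h
    nlinarith [abs_nonneg μ]
  have hp : (‖w‖ - |μ|) * (‖w‖ - |μ|) ≤ ‖(w + (β₁ * μ : ℝ)) * (w + (β₂ * μ : ℝ))‖ := by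
    rw [norm_mul]
    exact mul_le_mul (key _ h1) (key _ h2) (by linarith) (norm_nonneg _)
  have he : ‖Complex.exp (-2 * w * z)‖ ≤ 1 := by
    rw [Complex.norm_exp, Real.exp_le_one_iff]
    have : (-2 * w * z).re = -2 * w.re * z := by simp
    rw [this]; nlinarith [mul_nonneg hw hz.le]
  have hq : ‖((β₁ * β₂ : ℝ) : ℂ) * Complex.exp (-2 * w * z) * (w ^ 2 - (μ ^ 2 : ℝ))‖
      ≤ |β₁ * β₂| * (‖w‖ ^ 2 + |μ| ^ 2) := by
    rw [norm_mul, norm_mul, Complex.norm_real, Real.norm_eq_abs]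
    have := sq_bound w μ
    calc _ ≤ |β₁ * β₂| * 1 * (‖w‖ ^ 2 + |μ| ^ 2) := by gcongr
      _ = _ := by ring
  have hr := norm_sub_le (((β₁ * β₂ : ℝ) : ℂ) * Complex.exp (-2 * w * z) * (w ^ 2 - (μ ^ 2 : ℝ)) +
              (w + (β₁ * μ : ℝ)) * (w + (β₂ * μ : ℝ)))
      (((β₁ * β₂ : ℝ) : ℂ) * Complex.exp (-2 * w * z) * (w ^ 2 - (μ ^ 2 : ℝ)))
  rw [add_sub_cancel_left] at hr
  have hm := mul_le_mul_of_nonneg_right hW (norm_nonneg w)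
  have hm2 : 0 ≤ (1 - |β₁ * β₂|) * |μ| ^ 2 := mul_nonneg (by linarith) (sq_nonneg _)
  nlinarith

lemma lim_aux (K B t : ℝ) (ht : 0 < t) :
    Tendsto (fun r : ℝ => K * (r + B) ^ 2 * Real.exp (-(t / 2) * r ^ 2)) atTop (nhds 0) := by
  have h0 : ∀ n : ℕ, Tendsto (fun r : ℝ => r ^ n * Real.exp (-(t / 2) * r)) atTop (nhds 0) := by
    intro n
    have := tendsto_rpow_mul_exp_neg_mul_atTop_nhds_zero n (t / 2) (by positivity)
    simpa using this
  have hs : Tendsto (fun r : ℝ => K * (r + B) ^ 2 * Real.exp (-(t / 2) * r)) atTop (nhds 0) := by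
    have := (((h0 2).add ((h0 1).const_mul (2 * B))).add ((h0 0).const_mul (B ^ 2))).const_mul K
    simp only [mul_zero, add_zero] at this
    refine this.congr fun r => by ring
  refine squeeze_zero_norm' ?_ (by simpa only [norm_zero] using hs.norm)
  filter_upwards [eventually_ge_atTop (1 : ℝ)] with r hr
  rw [norm_mul _ (Real.exp (-(t / 2) * r ^ 2)), norm_mul _ (Real.exp (-(t / 2) * r))]
  refine mul_le_mul_of_nonneg_left ?_ (norm_nonneg (K * (r + B) ^ 2))
  rw [Real.norm_eq_abs, Real.norm_eq_abs, abs_of_pos (Real.exp_pos _), abs_of_pos (Real.exp_pos _)]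
  apply Real.exp_le_exp.2
  have hr2 : r ≤ r ^ 2 := by nlinarith
  have := mul_le_mul_of_nonneg_left hr2 (half_pos ht).le
  linarith

/-- Lemma 3.3 of the paper: the integral `I_u` of the contour integrand over the
horizontal segment `[iu, 𝔞 + iu]` vanishes as `u → ±∞`. -/
theorem stmt9 (β₁ β₂ μ t z 𝔞 x y : ℝ)
    (hβ₁ : β₁ ∈ Set.Icc (-1 : ℝ) 1) (hβ₂ : β₂ ∈ Set.Icc (-1 : ℝ) 1)
    (hββ : |β₁ * β₂| ≠ 1) (ht : 0 < t) (hz : 0 < z) (h𝔞 : 0 ≤ 𝔞)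
    (I : ℝ → ℂ)
    (hI : ∀ u : ℝ, I u =
      ∫ 𝔴 in (0 : ℝ)..𝔞,
        Complex.exp (((𝔴 : ℂ) + Complex.I * u) ^ 2 * t / 2) *
          Complex.exp (-((𝔴 : ℂ) + Complex.I * u) * (|x - y| : ℝ)) *
          ((c1 β₁ β₂ μ z y ((𝔴 : ℂ) + Complex.I * u) *
              Complex.exp (-((𝔴 : ℂ) + Complex.I * u) * (a1 z x y : ℝ)) +
            c2 β₁ β₂ μ z y ((𝔴 : ℂ) + Complex.I * u) *
              Complex.exp (-((𝔴 : ℂ) + Complex.I * u) * (a2 z x y : ℝ)) +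
            c3 β₁ β₂ μ z y ((𝔴 : ℂ) + Complex.I * u) *
              Complex.exp (-((𝔴 : ℂ) + Complex.I * u) * (a3 z x y : ℝ)) +
            c4 β₁ β₂ μ z y ((𝔴 : ℂ) + Complex.I * u) *
              Complex.exp (-((𝔴 : ℂ) + Complex.I * u) * (a4 z x y : ℝ))) /
            ((β₁ * β₂ : ℝ) * Complex.exp (-2 * ((𝔴 : ℂ) + Complex.I * u) * z) *
                (((𝔴 : ℂ) + Complex.I * u) ^ 2 - (μ ^ 2 : ℝ)) +
              (((𝔴 : ℂ) + Complex.I * u) + (β₁ * μ : ℝ)) *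
                (((𝔴 : ℂ) + Complex.I * u) + (β₂ * μ : ℝ))))) :
    Tendsto I atTop (nhds 0) ∧ Tendsto I atBot (nhds 0) := by
  have h1 : |β₁| ≤ 1 := abs_le.2 hβ₁
  have h2 : |β₂| ≤ 1 := abs_le.2 hβ₂
  have hb : |β₁ * β₂| < 1 := by
    refine lt_of_le_of_ne ?_ hββ
    rw [abs_mul]; exact mul_le_one₀ h1 (abs_nonneg _) h2
  set E : ℝ := Real.exp (𝔞 * |a1 z x y|) + Real.exp (𝔞 * |a2 z x y|) + Real.exp (𝔞 * |a3 z x y|)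
    + Real.exp (𝔞 * |a4 z x y|) with hE
  set K : ℝ := Real.exp (𝔞 ^ 2 * t / 2) * Real.exp (𝔞 * |(|x - y|)|) * E * |𝔞 - 0| with hK
  have main : ∀ l : Filter ℝ, Tendsto (fun u : ℝ => |u|) l atTop → Tendsto I l (nhds 0) := by
    intro l hl
    refine squeeze_zero_norm' ?_ ((lim_aux K (𝔞 + |μ|) t ht).comp hl)
    filter_upwards [hl.eventually_ge_atTop 1, hl.eventually_ge_atTop |μ|,
      hl.eventually_ge_atTop ((2 * |μ| + 1) / (1 - |β₁ * β₂|))] with u hu1 hu2 hu3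
    rw [div_le_iff₀' (by linarith)] at hu3
    rw [hI u]
    refine (intervalIntegral.norm_integral_le_of_norm_le_const
      (C := (Real.exp (𝔞 ^ 2 * t / 2) * Real.exp (-(t / 2) * |u| ^ 2)) *
        Real.exp (𝔞 * |(|x - y|)|) * ((|u| + (𝔞 + |μ|)) ^ 2 * E)) ?_).trans (le_of_eq ?_)
    · intro v hv
      rw [Set.uIoc_of_le h𝔞] at hv
      obtain ⟨hv0, hv1⟩ := hv
      have g1 := gauss_bound v u t 𝔞 ht hv0.le hv1
      have g2 := exp_bound v u (|x - y|) 𝔞 hv0.le hv1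
      have k1 := exp_bound v u (a1 z x y) 𝔞 hv0.le hv1
      have k2 := exp_bound v u (a2 z x y) 𝔞 hv0.le hv1
      have k3 := exp_bound v u (a3 z x y) 𝔞 hv0.le hv1
      have k4 := exp_bound v u (a4 z x y) 𝔞 hv0.le hv1
      have hre : ((v : ℂ) + Complex.I * u).re = v := by simp
      have him : ((v : ℂ) + Complex.I * u).im = u := by simp
      have hlow : |u| ≤ ‖(v : ℂ) + Complex.I * u‖ := by
        have := Complex.abs_im_le_norm ((v : ℂ) + Complex.I * u)
        rwa [him] at this
      have hup : ‖(v : ℂ) + Complex.I * u‖ ≤ |u| + 𝔞 := by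
        have := Complex.norm_le_abs_re_add_abs_im ((v : ℂ) + Complex.I * u)
        rw [hre, him, abs_of_pos hv0] at this
        linarith
      generalize (v : ℂ) + Complex.I * u = w at *
      have hd := den_bound β₁ β₂ μ z w h1 h2 hz (by rw [hre]; exact hv0.le) (by linarith)
        (by linarith) hb
        (hu3.trans (mul_le_mul_of_nonneg_left hlow (by linarith)))
      have hQ : (‖w‖ + |μ|) ^ 2 ≤ (|u| + (𝔞 + |μ|)) ^ 2 :=
        pow_le_pow_left₀ (by positivity) (by linarith) 2
      have q1 := (c1_bound β₁ β₂ μ z y w h1 h2).trans hQ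
      have q2 := (c2_bound β₁ β₂ μ z y w h1 h2).trans hQ
      have q3 := (c3_bound β₁ β₂ μ z y w h1 h2).trans hQ
      have q4 := (c4_bound β₁ β₂ μ z y w h1 h2).trans hQ
      rw [norm_mul, norm_mul, norm_div]
      refine mul_le_mul (mul_le_mul g1 g2 (norm_nonneg _) (by positivity)) ?_
        (by positivity) (by positivity)
      refine (div_le_self (norm_nonneg _) hd).trans ?_
      rw [hE, mul_add, mul_add, mul_add]
      refine (norm_add₄_le).trans ?_
      simp only [norm_mul]
      gcongr
    · simp only [Function.comp, hK]; ring
  exact ⟨main _ tendsto_abs_atTop_atTop, main _ tendsto_abs_atBot_atTop⟩
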